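/- arXiv:1302.5984 — 2 statements merged into one kernel-verified Lean document; each statement's English description precedes it below -/
import Mathlib

section
/- The series ∑_{n=0}^∞ ((1/3)_n (1/2)_n (2/3)_n / (n!)³) · (3(7√3 − 12)/2)^n · (5 − √3 + 22n) converges to (7 + 3√3)/π. -/
open Real Filter

/-- The Pochhammer symbol (rising factorial) `(a)_n = a (a+1) ⋯ (a+n-1)`. -/
noncomputable def poch (a : ℝ) (n : ℕ) : ℝ := (ascPochhammer ℝ n).eval a

/-! ### Real power series with polynomially bounded coefficients -/

/-- The sum of the power series with coefficients `a` at `x`. -/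
noncomputable def powSum (a : ℕ → ℝ) (x : ℝ) : ℝ := ∑' n, a n * x ^ n

/-- The coefficients of the derivative of a power series. -/
def derivCoeff (a : ℕ → ℝ) (n : ℕ) : ℝ := (n + 1) * a (n + 1)

/-- The coefficients of the image of a power series under the Euler operator `x d/dx`. -/
def eulerCoeff (a : ℕ → ℝ) (n : ℕ) : ℝ := n * a n

/-- The sequence `a` grows at most polynomially. -/
def PolyBounded (a : ℕ → ℝ) : Prop := ∃ (C : ℝ) (k : ℕ), ∀ n, |a n| ≤ C * ((n : ℝ) + 1) ^ k

lemma PolyBounded.derivCoeff {a : ℕ → ℝ} (ha : PolyBounded a) : PolyBounded (derivCoeff a) := by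
  obtain ⟨C, k, h⟩ := ha
  have hC : 0 ≤ C := by simpa using (abs_nonneg _).trans (h 0)
  refine ⟨C * 2 ^ k, k + 1, fun n => ?_⟩
  have h1 := h (n + 1)
  have hn : (0 : ℝ) ≤ n := n.cast_nonneg
  have h2 : (((n + 1 : ℕ) : ℝ) + 1) ^ k ≤ (2 * ((n : ℝ) + 1)) ^ k := by
    gcongr
    push_cast
    linarith
  rw [_root_.derivCoeff, abs_mul, abs_of_nonneg (by positivity)]
  calc ((n : ℝ) + 1) * |a (n + 1)| ≤ ((n : ℝ) + 1) * (C * (2 * ((n : ℝ) + 1)) ^ k) := by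
        gcongr
        exact h1.trans (by gcongr)
    _ = C * 2 ^ k * ((n : ℝ) + 1) ^ (k + 1) := by rw [mul_pow]; ring

lemma PolyBounded.eulerCoeff {a : ℕ → ℝ} (ha : PolyBounded a) : PolyBounded (eulerCoeff a) := by
  obtain ⟨C, k, h⟩ := ha
  refine ⟨C, k + 1, fun n => ?_⟩
  have hn : (0 : ℝ) ≤ n := n.cast_nonneg
  rw [_root_.eulerCoeff, abs_mul, abs_of_nonneg hn]
  calc (n : ℝ) * |a n| ≤ ((n : ℝ) + 1) * (C * ((n : ℝ) + 1) ^ k) := by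
        gcongr
        · linarith
        · exact h n
    _ = C * ((n : ℝ) + 1) ^ (k + 1) := by ring

lemma PolyBounded.of_abs_le_one {a : ℕ → ℝ} (ha : ∀ n, |a n| ≤ 1) : PolyBounded a :=
  ⟨1, 0, by simpa using ha⟩

lemma summable_shift {f : ℕ → ℝ} (hf : Summable f) : Summable fun n => f (n + 1) :=
  hf.comp_injective (add_left_injective 1)

lemma PolyBounded.summable_abs {a : ℕ → ℝ} (ha : PolyBounded a) {x : ℝ} (hx : |x| < 1) :
    Summable fun n => |a n * x ^ n| := by
  obtain ⟨C, k, h⟩ := ha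
  have hC : 0 ≤ C := by simpa using (abs_nonneg _).trans (h 0)
  obtain ⟨s, hxs, hs⟩ := exists_between hx
  have hs0 : 0 < s := (abs_nonneg x).trans_lt hxs
  have hs' : ‖s‖ < 1 := by rwa [Real.norm_eq_abs, abs_of_pos hs0]
  have h1 := summable_shift (summable_pow_mul_geometric_of_norm_lt_one k hs')
  refine Summable.of_nonneg_of_le (fun n => abs_nonneg _) (fun n => ?_) (h1.mul_left (C / s))
  rw [abs_mul, abs_pow]
  calc |a n| * |x| ^ n ≤ (C * ((n : ℝ) + 1) ^ k) * s ^ n := by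
        gcongr
        exact h n
    _ = C / s * (((n + 1 : ℕ) : ℝ) ^ k * s ^ (n + 1)) := by
        push_cast
        field_simp
        ring

lemma PolyBounded.summable {a : ℕ → ℝ} (ha : PolyBounded a) {x : ℝ} (hx : |x| < 1) :
    Summable fun n => a n * x ^ n := (ha.summable_abs hx).of_abs

lemma PolyBounded.hasDerivAt {a : ℕ → ℝ} (ha : PolyBounded a) {x : ℝ} (hx : |x| < 1) :
    HasDerivAt (powSum a) (powSum (_root_.derivCoeff a) x) x := by
  obtain ⟨s, hxs, hs⟩ := exists_between hx
  have hs0 : 0 < s := (abs_nonneg x).trans_lt hxs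
  have hu : Summable fun n : ℕ => |a n| * (n * s ^ (n - 1)) := by
    refine (summable_nat_add_iff (f := fun n : ℕ => |a n| * (n * s ^ (n - 1))) 1).mp ?_
    refine (ha.derivCoeff.summable_abs (x := s) (by rwa [abs_of_pos hs0])).congr fun n => ?_
    rw [_root_.derivCoeff, abs_mul, abs_mul, abs_of_nonneg (by positivity : (0 : ℝ) ≤ n + 1),
      abs_of_nonneg (by positivity : 0 ≤ s ^ n)]
    push_cast
    ring
  have key : HasDerivAt (fun z => ∑' n, a n * z ^ n) (∑' n : ℕ, a n * (n * x ^ (n - 1))) x := by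
    refine hasDerivAt_tsum_of_isPreconnected (t := Metric.ball (0 : ℝ) s) (y₀ := x)
      (g := fun n z => a n * z ^ n) (g' := fun n z => a n * (n * z ^ (n - 1))) hu Metric.isOpen_ball
      (convex_ball (0 : ℝ) s).isPreconnected (fun n y _ => ?_) (fun n y hy => ?_)
      (by simpa using hxs) (ha.summable hx) (by simpa using hxs)
    · exact (hasDerivAt_pow n y).const_mul (a n)
    · have hy' : |y| < s := by simpa using hy
      rw [Real.norm_eq_abs, abs_mul, abs_mul, abs_pow, Nat.abs_cast]
      gcongr
  have hsum : Summable fun n : ℕ => a n * (n * x ^ (n - 1)) := by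
    refine (summable_nat_add_iff (f := fun n : ℕ => a n * (n * x ^ (n - 1))) 1).mp ?_
    refine (ha.derivCoeff.summable hx).congr fun n => ?_
    simp [_root_.derivCoeff]
    ring
  convert! key using 1
  rw [hsum.tsum_eq_zero_add, powSum]
  simp only [Nat.cast_zero, zero_mul, mul_zero, zero_add]
  refine tsum_congr fun n => ?_
  simp [_root_.derivCoeff]
  ring

lemma PolyBounded.powSum_eulerCoeff {a : ℕ → ℝ} (ha : PolyBounded a) {x : ℝ} (hx : |x| < 1) :
    powSum (_root_.eulerCoeff a) x = x * powSum (_root_.derivCoeff a) x := by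
  rw [powSum, (ha.eulerCoeff.summable hx).tsum_eq_zero_add, powSum, ← tsum_mul_left]
  simp only [_root_.eulerCoeff, _root_.derivCoeff, Nat.cast_zero, zero_mul, zero_add]
  refine tsum_congr fun n => ?_
  push_cast
  ring

lemma powSum_zero (a : ℕ → ℝ) : powSum a 0 = a 0 := by
  rw [powSum, tsum_eq_single 0 fun n hn => by simp [hn]]
  simp

lemma PolyBounded.continuousAt {a : ℕ → ℝ} (ha : PolyBounded a) {x : ℝ} (hx : |x| < 1) :
    ContinuousAt (powSum a) x := (ha.hasDerivAt hx).continuousAt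

lemma PolyBounded.one_le_powSum {a : ℕ → ℝ} (ha : PolyBounded a) (h0 : a 0 = 1)
    (hpos : ∀ n, 0 ≤ a n) {x : ℝ} (hx0 : 0 ≤ x) (hx : x < 1) : 1 ≤ powSum a x := by
  have := (ha.summable (x := x) (by rwa [abs_of_nonneg hx0])).le_tsum 0
    fun n _ => mul_nonneg (hpos n) (pow_nonneg hx0 n)
  simpa [h0, powSum] using this

/-- A consequence of Abel's limit theorem: if the coefficients converge to `l`, then
`(1 - x) ∑ aₙ xⁿ` tends to `l` as `x` tends to `1` from the left. -/
lemma PolyBounded.tendsto_one_sub_mul_powSum {a : ℕ → ℝ} (ha : PolyBounded a) {l : ℝ}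
    (hl : Tendsto a atTop (nhds l)) :
    Tendsto (fun x => (1 - x) * powSum a x) (nhdsWithin 1 (Set.Iio 1)) (nhds l) := by
  let b : ℕ → ℝ := fun n => Nat.casesOn n (a 0) fun m => a (m + 1) - a m
  have hb : Tendsto (fun n => ∑ i ∈ Finset.range n, b i) atTop (nhds l) := by
    rw [← tendsto_add_atTop_iff_nat 1]
    refine hl.congr fun n => ?_
    induction n with
    | zero => simp [b]
    | succ n ih => rw [Finset.sum_range_succ, ← ih]; simp [b]
  refine (Real.tendsto_tsum_powerSeries_nhdsWithin_lt hb).congr' ?_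
  filter_upwards [Ioo_mem_nhdsLT (show (0 : ℝ) < 1 by norm_num)] with x hx
  have hx1 : |x| < 1 := by rw [abs_of_pos hx.1]; exact hx.2
  have hs := ha.summable hx1
  have hs1 := summable_shift hs
  have hs2 : Summable fun n => b (n + 1) * x ^ (n + 1) :=
    (hs1.sub (hs.mul_left x)).congr fun n => by simp only [b]; ring
  rw [((summable_nat_add_iff (f := fun n => b n * x ^ n) 1).mp hs2).tsum_eq_zero_add]
  have h3 : ∑' n, b (n + 1) * x ^ (n + 1)
      = ∑' n, a (n + 1) * x ^ (n + 1) - x * ∑' n, a n * x ^ n := by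
    rw [← tsum_mul_left, ← hs1.tsum_sub (hs.mul_left x)]
    exact tsum_congr fun n => by simp only [b]; ring
  have h4 := hs.tsum_eq_zero_add
  simp only [b, pow_zero, mul_one] at h3 h4 ⊢
  rw [h3, powSum]
  linear_combination -h4

/-! ### Gauss hypergeometric coefficients -/

/-- The coefficients of the Gauss hypergeometric series `₂F₁(a, b; 1; x)`. -/
noncomputable def gaussCoeff (a b : ℝ) (n : ℕ) : ℝ :=
  poch a n * poch b n / (n.factorial : ℝ) ^ 2

lemma poch_zero (a : ℝ) : poch a 0 = 1 := by simp [poch]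

lemma poch_succ (a : ℝ) (n : ℕ) : poch a (n + 1) = poch a n * (a + n) :=
  ascPochhammer_succ_eval n a

lemma poch_pos {a : ℝ} (ha : 0 < a) (n : ℕ) : 0 < poch a n := by
  induction n with
  | zero => simp [poch_zero]
  | succ n ih => rw [poch_succ]; positivity

lemma poch_le_factorial {a : ℝ} (ha : 0 < a) (ha1 : a ≤ 1) (n : ℕ) :
    poch a n ≤ n.factorial := by
  induction n with
  | zero => simp [poch_zero]
  | succ n ih =>
    rw [poch_succ, Nat.factorial_succ, mul_comm]
    push_cast
    refine mul_le_mul (by linarith) ih (poch_pos ha n).le (by positivity)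

lemma gaussCoeff_zero (a b : ℝ) : gaussCoeff a b 0 = 1 := by simp [gaussCoeff, poch_zero]

lemma gaussCoeff_succ (a b : ℝ) (n : ℕ) :
    ((n : ℝ) + 1) ^ 2 * gaussCoeff a b (n + 1) = (n + a) * (n + b) * gaussCoeff a b n := by
  have : (n.factorial : ℝ) ≠ 0 := by positivity
  simp only [gaussCoeff, poch_succ, Nat.factorial_succ]
  push_cast
  field_simp
  ring

lemma gaussCoeff_nonneg {a b : ℝ} (ha : 0 < a) (hb : 0 < b) (n : ℕ) : 0 ≤ gaussCoeff a b n := by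
  have := poch_pos ha n
  have := poch_pos hb n
  unfold gaussCoeff
  positivity

lemma gaussCoeff_polyBounded {a b : ℝ} (ha : 0 < a) (ha1 : a ≤ 1) (hb : 0 < b) (hb1 : b ≤ 1) :
    PolyBounded (gaussCoeff a b) := by
  refine PolyBounded.of_abs_le_one fun n => ?_
  rw [abs_of_nonneg (gaussCoeff_nonneg ha hb n), gaussCoeff, div_le_one (by positivity), sq]
  exact mul_le_mul (poch_le_factorial ha ha1 n) (poch_le_factorial hb hb1 n) (poch_pos hb n).le
    (by positivity)

/-- The hypergeometric differential equation, in terms of the Euler operator. -/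
lemma one_sub_mul_powSum_derivCoeff_eulerCoeff {a b : ℝ} {h : ℕ → ℝ} (hh : PolyBounded h)
    (hrec : ∀ n : ℕ, ((n : ℝ) + 1) ^ 2 * h (n + 1) = (n + a) * (n + b) * h n)
    {x : ℝ} (hx : |x| < 1) :
    (1 - x) * powSum (derivCoeff (eulerCoeff h)) x
      = (a + b) * powSum (eulerCoeff h) x + a * b * powSum h x := by
  have h0 := hh.summable hx
  have h1 := hh.eulerCoeff.summable hx
  have h2 := hh.eulerCoeff.eulerCoeff.summable hx
  have key : powSum (derivCoeff (eulerCoeff h)) x = powSum (eulerCoeff (eulerCoeff h)) x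
      + (a + b) * powSum (eulerCoeff h) x + a * b * powSum h x := by
    simp only [powSum]
    rw [← tsum_mul_left, ← tsum_mul_left, ← h2.tsum_add (h1.mul_left _),
      ← (h2.add (h1.mul_left _)).tsum_add (h0.mul_left _)]
    refine tsum_congr fun n => ?_
    simp only [derivCoeff, eulerCoeff]
    push_cast
    linear_combination x ^ n * hrec n
  rw [hh.eulerCoeff.powSum_eulerCoeff hx] at key
  linear_combination key

/-! ### Clausen's identity -/

section Clausen

open PowerSeries

/-- The Euler operator `X d/dX` on formal power series. -/
noncomputable def euler (f : PowerSeries ℝ) : PowerSeries ℝ := X * derivative ℝ f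

lemma coeff_euler (f : PowerSeries ℝ) (n : ℕ) : coeff n (euler f) = n * coeff n f := by
  cases n with
  | zero => simp [euler]
  | succ n =>
    rw [euler, coeff_succ_X_mul, coeff_derivative]
    push_cast
    ring

lemma euler_mul (f g : PowerSeries ℝ) : euler (f * g) = euler f * g + f * euler g := by
  simp only [euler, Derivation.leibniz, smul_eq_mul]
  ring

lemma euler_add (f g : PowerSeries ℝ) : euler (f + g) = euler f + euler g := by
  simp only [euler, map_add, mul_add]

lemma euler_X : euler X = X := by simp [euler]

lemma euler_C (r : ℝ) : euler (C r) = 0 := by simp [euler]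

/-- The coefficients of the series `₃F₂(1/3, 1/2, 2/3; 1, 1; x)`. -/
noncomputable def clausenCoeff (n : ℕ) : ℝ :=
  poch (1 / 3) n * poch (1 / 2) n * poch (2 / 3) n / (n.factorial : ℝ) ^ 3

lemma clausenCoeff_succ (n : ℕ) : ((n : ℝ) + 1) ^ 3 * clausenCoeff (n + 1)
    = (n + 1 / 3) * (n + 1 / 2) * (n + 2 / 3) * clausenCoeff n := by
  have : (n.factorial : ℝ) ≠ 0 := by positivity
  simp only [clausenCoeff, poch_succ, Nat.factorial_succ]
  push_cast
  field_simp
  ring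

lemma clausenCoeff_polyBounded : PolyBounded clausenCoeff := by
  refine PolyBounded.of_abs_le_one fun n => ?_
  have h1 := poch_pos (show (0 : ℝ) < 1 / 3 by norm_num) n
  have h2 := poch_pos (show (0 : ℝ) < 1 / 2 by norm_num) n
  have h3 := poch_pos (show (0 : ℝ) < 2 / 3 by norm_num) n
  have h4 := poch_le_factorial (show (0 : ℝ) < 1 / 3 by norm_num) (by norm_num) n
  have h5 := poch_le_factorial (show (0 : ℝ) < 1 / 2 by norm_num) (by norm_num) n
  have h6 := poch_le_factorial (show (0 : ℝ) < 2 / 3 by norm_num) (by norm_num) n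
  rw [clausenCoeff, abs_of_nonneg (by positivity), div_le_one (by positivity)]
  calc _ ≤ (n.factorial : ℝ) * n.factorial * n.factorial := by gcongr
    _ = _ := by ring

lemma coeff_sq_gauss_succ (n : ℕ) :
    ((n : ℝ) + 1) ^ 3 * coeff (n + 1) (mk (gaussCoeff (1 / 6) (1 / 3)) ^ 2)
      = (n + 1 / 3) * (n + 1 / 2) * (n + 2 / 3)
        * coeff n (mk (gaussCoeff (1 / 6) (1 / 3)) ^ 2) := by
  set A : PowerSeries ℝ := mk (gaussCoeff (1 / 6) (1 / 3)) with hA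
  set B := euler A with hB
  set D := euler B with hD
  set E := euler D with hE
  have hODE : D = X * (D + C (1 / 2) * B + C (1 / 18) * A) := by
    ext m
    cases m with
    | zero => simp [hD, coeff_euler]
    | succ m =>
      simp only [coeff_succ_X_mul, map_add, coeff_C_mul, hD, hB, coeff_euler]
      simp only [hA, coeff_mk]
      have := gaussCoeff_succ (1 / 6) (1 / 3) m
      push_cast
      linear_combination this
  have hODE' : E = X * (D + C (1 / 2) * B + C (1 / 18) * A)
      + X * (E + C (1 / 2) * D + C (1 / 18) * B) := by
    have := congrArg euler hODE
    simpa only [euler_mul, euler_add, euler_X, euler_C, zero_mul, zero_add, ← hB, ← hD, ← hE]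
      using this
  have e1 : euler (A ^ 2) = 2 * A * B := by
    rw [sq, euler_mul, ← hB]
    ring
  have e2 : euler (euler (A ^ 2)) = 2 * B ^ 2 + 2 * A * D := by
    rw [e1, show 2 * A * B = A * B + A * B by ring, euler_add, euler_mul, ← hB, ← hD]
    ring
  have e3 : euler (euler (euler (A ^ 2))) = 6 * B * D + 2 * A * E := by
    rw [e2, show 2 * B ^ 2 + 2 * A * D = B * B + B * B + (A * D + A * D) by ring, euler_add,
      euler_add, euler_add, euler_mul, euler_mul, ← hB, ← hD, ← hE]
    ring
  have c1 : (C (3 / 2) : PowerSeries ℝ) = 27 * C (1 / 18) := by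
    rw [← map_ofNat C 27, ← map_mul]; norm_num
  have c2 : (C (13 / 18) : PowerSeries ℝ) = 13 * C (1 / 18) := by
    rw [← map_ofNat C 13, ← map_mul]; norm_num
  have c3 : (C (1 / 9) : PowerSeries ℝ) = 2 * C (1 / 18) := by
    rw [← map_ofNat C 2, ← map_mul]; norm_num
  have c4 : (C (1 / 2) : PowerSeries ℝ) = 9 * C (1 / 18) := by
    rw [← map_ofNat C 9, ← map_mul]; norm_num
  have c5 : (18 * C (1 / 18) : PowerSeries ℝ) = 1 := by
    rw [← map_ofNat C 18, ← map_mul]; norm_num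
  have key : euler (euler (euler (A ^ 2))) = X * (euler (euler (euler (A ^ 2)))
      + C (3 / 2) * euler (euler (A ^ 2)) + C (13 / 18) * euler (A ^ 2) + C (1 / 9) * A ^ 2) := by
    rw [e3, e2, e1]
    rw [c4] at hODE hODE'
    rw [c1, c2, c3]
    linear_combination 6 * B * hODE + 2 * A * hODE' - 2 * X * A * D * c5
  have := congrArg (coeff (n + 1)) key
  simp only [coeff_succ_X_mul, map_add, coeff_C_mul, coeff_euler] at this
  push_cast at this
  linear_combination this

lemma coeff_sq_gauss (n : ℕ) :
    coeff n (mk (gaussCoeff (1 / 6) (1 / 3)) ^ 2) = clausenCoeff n := by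
  induction n with
  | zero => simp [gaussCoeff_zero, clausenCoeff, poch_zero]
  | succ n ih =>
    have h1 := coeff_sq_gauss_succ n
    rw [ih, ← clausenCoeff_succ] at h1
    exact mul_left_cancel₀ (by positivity) h1

lemma powSum_clausenCoeff {z : ℝ} (hz : |z| < 1) :
    powSum clausenCoeff z = powSum (gaussCoeff (1 / 6) (1 / 3)) z ^ 2 := by
  have hs := (gaussCoeff_polyBounded (a := 1 / 6) (b := 1 / 3) (by norm_num) (by norm_num)
    (by norm_num) (by norm_num)).summable_abs hz
  have hprod := tsum_mul_tsum_eq_tsum_sum_antidiagonal_of_summable_norm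
    (f := fun n => gaussCoeff (1 / 6) (1 / 3) n * z ^ n)
    (g := fun n => gaussCoeff (1 / 6) (1 / 3) n * z ^ n) hs hs
  rw [sq, powSum, powSum, hprod]
  refine tsum_congr fun n => ?_
  rw [← coeff_sq_gauss, sq, coeff_mul, Finset.sum_mul]
  refine Finset.sum_congr rfl fun p hp => ?_
  rw [coeff_mk, coeff_mk, ← Finset.HasAntidiagonal.mem_antidiagonal.mp hp]
  ring

end Clausen

lemma powSum_eulerCoeff_clausenCoeff {z : ℝ} (hz : |z| < 1) :
    powSum (eulerCoeff clausenCoeff) z = 2 * powSum (gaussCoeff (1 / 6) (1 / 3)) z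
      * powSum (eulerCoeff (gaussCoeff (1 / 6) (1 / 3))) z := by
  have hK := gaussCoeff_polyBounded (a := 1 / 6) (b := 1 / 3) (by norm_num) (by norm_num)
    (by norm_num) (by norm_num)
  have h1 := (hK.hasDerivAt hz).pow 2
  have h2 := clausenCoeff_polyBounded.hasDerivAt hz
  have h3 : powSum clausenCoeff =ᶠ[nhds z] powSum (gaussCoeff (1 / 6) (1 / 3)) ^ 2 := by
    filter_upwards [(isOpen_lt continuous_abs continuous_const).mem_nhds hz] with x hx
    exact powSum_clausenCoeff hx
  have h4 := h2.unique (h1.congr_of_eventuallyEq h3)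
  rw [clausenCoeff_polyBounded.powSum_eulerCoeff hz, hK.powSum_eulerCoeff hz, h4]
  push_cast
  ring

/-! ### Comparison of solutions of a second order equation -/

lemma eq_left_of_hasDerivAt_zero {f : ℝ → ℝ} {c : ℝ} (hf : ContinuousOn f (Set.Icc 0 c))
    (hf' : ∀ x ∈ Set.Ioo 0 c, HasDerivAt f 0 x) : ∀ x ∈ Set.Icc 0 c, f x = f 0 := by
  intro x hx
  rcases hx.1.eq_or_lt with h0 | h0
  · rw [← h0]
  obtain ⟨y, -, h⟩ := exists_hasDerivAt_eq_slope f (fun _ => 0) h0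
    (hf.mono (Set.Icc_subset_Icc_right hx.2)) fun y hy => hf' y ⟨hy.1, hy.2.trans_le hx.2⟩
  rw [eq_comm, div_eq_zero_iff] at h
  rcases h with h | h <;> linarith

/-- Two solutions `A`, `B` of the equation `D (w D y) = q y`, where `D = d/dx`, coincide if at `0`
they have equal values and both `w D A` and `w D B` vanish. -/
lemma eq_of_sturm_liouville {A B P Q w q : ℝ → ℝ} {c : ℝ} (hc : 0 ≤ c)
    (cA : ContinuousOn A (Set.Icc 0 c)) (cB : ContinuousOn B (Set.Icc 0 c))
    (cP : ContinuousOn P (Set.Icc 0 c)) (cQ : ContinuousOn Q (Set.Icc 0 c))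
    (hA : ∀ x ∈ Set.Ioo 0 c, ∃ d, HasDerivAt A d x ∧ w x * d = P x)
    (hB : ∀ x ∈ Set.Ioo 0 c, ∃ d, HasDerivAt B d x ∧ w x * d = Q x)
    (hP : ∀ x ∈ Set.Ioo 0 c, HasDerivAt P (q x * A x) x)
    (hQ : ∀ x ∈ Set.Ioo 0 c, HasDerivAt Q (q x * B x) x)
    (hw : ∀ x ∈ Set.Ioo 0 c, w x ≠ 0) (hpos : ∀ x ∈ Set.Icc 0 c, 0 < A x)
    (h0 : A 0 = B 0) (hP0 : P 0 = 0) (hQ0 : Q 0 = 0) : A c = B c ∧ P c = Q c := by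
  have hM : ∀ x ∈ Set.Icc 0 c, A x * Q x = B x * P x := by
    intro x hx
    have := eq_left_of_hasDerivAt_zero (f := fun x => A x * Q x - B x * P x)
      ((cA.mul cQ).sub (cB.mul cP)) (fun x hx => ?_) x hx
    · simp only [hP0, hQ0, mul_zero, sub_zero] at this
      linarith
    · obtain ⟨d, hd, hdP⟩ := hA x hx
      obtain ⟨e, he, heQ⟩ := hB x hx
      convert! (hd.mul (hQ x hx)).sub (he.mul (hP x hx)) using 1
      rw [← hdP, ← heQ]
      ring
  have hR := eq_left_of_hasDerivAt_zero (f := fun x => B x / A x)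
    (cB.div cA fun x hx => (hpos x hx).ne') (fun x hx => ?_) c ⟨hc, le_rfl⟩
  · have hA0 := (hpos 0 ⟨le_rfl, hc⟩).ne'
    have hAc := (hpos c ⟨hc, le_rfl⟩).ne'
    have hAB : A c = B c := by
      simp only [← h0, div_self hA0] at hR
      exact ((div_eq_one_iff_eq hAc).mp hR).symm
    refine ⟨hAB, ?_⟩
    have := hM c ⟨hc, le_rfl⟩
    rw [← hAB] at this
    exact (mul_left_cancel₀ hAc this).symm
  · obtain ⟨d, hd, hdP⟩ := hA x hx
    obtain ⟨e, he, heQ⟩ := hB x hx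
    have hx' := Set.Ioo_subset_Icc_self hx
    convert! he.div hd (hpos x hx').ne' using 1
    have h1 : e * A x - B x * d = 0 := by
      refine mul_left_cancel₀ (hw x hx) ?_
      linear_combination A x * heQ - B x * hdP + hM x hx'
    rw [h1, zero_div]

/-! ### The cubic hypergeometric function `₂F₁(1/3, 2/3; 1; t)` -/

/-- The function `F(t) = ₂F₁(1/3, 2/3; 1; t)`. -/
noncomputable def cubicF (t : ℝ) : ℝ := powSum (gaussCoeff (1 / 3) (2 / 3)) t

/-- The function `t (1 - t) dF/dt`, where `F` is `cubicF`. -/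
noncomputable def cubicP (t : ℝ) : ℝ :=
  (1 - t) * powSum (eulerCoeff (gaussCoeff (1 / 3) (2 / 3))) t

lemma cubicCoeff_polyBounded : PolyBounded (gaussCoeff (1 / 3) (2 / 3)) :=
  gaussCoeff_polyBounded (by norm_num) (by norm_num) (by norm_num) (by norm_num)

lemma hasDerivAt_cubicF {t : ℝ} (ht : |t| < 1) :
    ∃ d, HasDerivAt cubicF d t ∧ t * (1 - t) * d = cubicP t := by
  refine ⟨_, cubicCoeff_polyBounded.hasDerivAt ht, ?_⟩
  rw [cubicP, cubicCoeff_polyBounded.powSum_eulerCoeff ht]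
  ring

lemma hasDerivAt_cubicP {t : ℝ} (ht : |t| < 1) : HasDerivAt cubicP (2 / 9 * cubicF t) t := by
  have h1 := cubicCoeff_polyBounded.eulerCoeff.hasDerivAt ht
  have h2 := one_sub_mul_powSum_derivCoeff_eulerCoeff cubicCoeff_polyBounded
    (gaussCoeff_succ _ _) ht
  convert! ((hasDerivAt_id t).const_sub 1).mul h1 using 1
  simp only [cubicF, id]
  linear_combination -h2

lemma cubicF_zero : cubicF 0 = 1 := by rw [cubicF, powSum_zero, gaussCoeff_zero]

lemma cubicP_zero : cubicP 0 = 0 := by simp [cubicP, powSum_zero, eulerCoeff]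

lemma one_le_cubicF {t : ℝ} (ht0 : 0 ≤ t) (ht : t < 1) : 1 ≤ cubicF t :=
  cubicCoeff_polyBounded.one_le_powSum (gaussCoeff_zero _ _)
    (gaussCoeff_nonneg (by norm_num) (by norm_num)) ht0 ht

lemma continuousAt_cubicF {t : ℝ} (ht : |t| < 1) : ContinuousAt cubicF t :=
  cubicCoeff_polyBounded.continuousAt ht

lemma continuousAt_cubicP {t : ℝ} (ht : |t| < 1) : ContinuousAt cubicP t :=
  (hasDerivAt_cubicP ht).continuousAt

lemma hasDerivAt_comp {f g : ℝ → ℝ} {d e x : ℝ} (hg : HasDerivAt g e x)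
    (hf : HasDerivAt f d (g x)) : HasDerivAt (fun y => f (g y)) (d * e) x :=
  hf.comp x hg

/-- The quadratic transformation `₂F₁(1/3, 2/3; 1; t) = ₂F₁(1/6, 1/3; 1; 4t(1 - t))`, together with
its derivative. -/
lemma cubicF_quadratic_transformation {c : ℝ} (hc0 : 0 ≤ c) (hc : c < 1 / 2) :
    cubicF c = powSum (gaussCoeff (1 / 6) (1 / 3)) (4 * c * (1 - c)) ∧
    cubicP c = (1 - 2 * c) * powSum (eulerCoeff (gaussCoeff (1 / 6) (1 / 3)))
      (4 * c * (1 - c)) := by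
  have hK := gaussCoeff_polyBounded (a := 1 / 6) (b := 1 / 3) (by norm_num) (by norm_num)
    (by norm_num) (by norm_num)
  have hx : ∀ x ∈ Set.Icc 0 c, |x| < 1 := fun x hx => by
    rw [abs_of_nonneg hx.1]
    linarith [hx.2]
  have hz : ∀ x ∈ Set.Icc 0 c, |4 * x * (1 - x)| < 1 := fun x hx => by
    rw [abs_of_nonneg (mul_nonneg (by linarith [hx.1]) (by linarith [hx.2]))]
    nlinarith [hx.2, hx.1]
  have dz : ∀ x : ℝ, HasDerivAt (fun x : ℝ => 4 * x * (1 - x)) (4 * (1 - 2 * x)) x := fun x => by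
    convert! ((hasDerivAt_id x).const_mul 4).mul ((hasDerivAt_id x).const_sub 1) using 1
    simp only [id]
    ring
  have dK : ∀ x ∈ Set.Icc 0 c, HasDerivAt
      (fun x => powSum (gaussCoeff (1 / 6) (1 / 3)) (4 * x * (1 - x)))
      (powSum (derivCoeff (gaussCoeff (1 / 6) (1 / 3))) (4 * x * (1 - x)) * (4 * (1 - 2 * x))) x :=
    fun x hx => hasDerivAt_comp (dz x) (hK.hasDerivAt (hz x hx))
  have dL : ∀ x ∈ Set.Icc 0 c, HasDerivAt
      (fun x => (1 - 2 * x) * powSum (eulerCoeff (gaussCoeff (1 / 6) (1 / 3))) (4 * x * (1 - x)))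
      (2 / 9 * powSum (gaussCoeff (1 / 6) (1 / 3)) (4 * x * (1 - x))) x := fun x hx => by
    have h1 := hasDerivAt_comp (dz x) (hK.eulerCoeff.hasDerivAt (hz x hx))
    have h2 := one_sub_mul_powSum_derivCoeff_eulerCoeff hK (gaussCoeff_succ _ _) (hz x hx)
    convert! (((hasDerivAt_id x).const_mul 2).const_sub 1).mul h1 using 1
    simp only [id]
    linear_combination -4 * h2
  refine eq_of_sturm_liouville (w := fun x => x * (1 - x)) (q := fun _ => 2 / 9) hc0
    (fun x h => (continuousAt_cubicF (hx x h)).continuousWithinAt)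
    (fun x h => (dK x h).continuousAt.continuousWithinAt)
    (fun x h => (continuousAt_cubicP (hx x h)).continuousWithinAt)
    (fun x h => (dL x h).continuousAt.continuousWithinAt)
    (fun x h => hasDerivAt_cubicF (hx x (Set.Ioo_subset_Icc_self h)))
    (fun x h => ⟨_, dK x (Set.Ioo_subset_Icc_self h), ?_⟩)
    (fun x h => hasDerivAt_cubicP (hx x (Set.Ioo_subset_Icc_self h)))
    (fun x h => dL x (Set.Ioo_subset_Icc_self h))
    (fun x h => mul_ne_zero h.1.ne' (by linarith [h.2]))
    (fun x h => zero_lt_one.trans_le (one_le_cubicF h.1 (by linarith [h.2])))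
    ?_ cubicP_zero ?_
  · simp only [hK.powSum_eulerCoeff (hz x (Set.Ioo_subset_Icc_self h))]
    ring
  · simp [cubicF_zero, powSum_zero, gaussCoeff_zero]
  · simp [powSum_zero, eulerCoeff]

/-- The cubic transformation `(1 + 2x) F(x³) = F(1 - ((1 - x) / (1 + 2x))³)`, together with
its derivative. -/
lemma cubicF_cubic_transformation {c : ℝ} (hc0 : 0 ≤ c) (hc : c < 1) :
    (1 + 2 * c) * cubicF (c ^ 3) = cubicF (1 - ((1 - c) / (1 + 2 * c)) ^ 3) ∧
    2 * c * (1 - c ^ 3) / (1 + 2 * c) ^ 2 * cubicF (c ^ 3) + 3 / (1 + 2 * c) * cubicP (c ^ 3)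
      = cubicP (1 - ((1 - c) / (1 + 2 * c)) ^ 3) := by
  have hne : ∀ x ∈ Set.Icc 0 c, 1 + 2 * x ≠ 0 := fun x hx => by linarith [hx.1]
  have hv : ∀ x ∈ Set.Icc 0 c, |x ^ 3| < 1 := fun x hx => by
    rw [abs_of_nonneg (pow_nonneg hx.1 3)]
    exact pow_lt_one₀ hx.1 (hx.2.trans_lt hc) (by norm_num)
  have hu : ∀ x ∈ Set.Icc 0 c, |1 - ((1 - x) / (1 + 2 * x)) ^ 3| < 1 := fun x hx => by
    have h1 : 0 < (1 - x) / (1 + 2 * x) := div_pos (by linarith [hx.2]) (by linarith [hx.1])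
    have h2 : (1 - x) / (1 + 2 * x) ≤ 1 := by
      rw [div_le_one (by linarith [hx.1])]
      linarith [hx.1]
    have h3 := pow_pos h1 3
    have h4 := pow_le_one₀ (n := 3) h1.le h2
    rw [abs_of_nonneg (by linarith)]
    linarith
  have dv : ∀ x : ℝ, HasDerivAt (fun x : ℝ => x ^ 3) (3 * x ^ 2) x := fun x => by
    simpa using hasDerivAt_pow 3 x
  have dl : ∀ x : ℝ, HasDerivAt (fun x : ℝ => 1 + 2 * x) 2 x := fun x => by
    simpa using ((hasDerivAt_id x).const_mul 2).const_add 1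
  have du : ∀ x ∈ Set.Icc 0 c, HasDerivAt (fun x : ℝ => 1 - ((1 - x) / (1 + 2 * x)) ^ 3)
      (9 * (1 - x) ^ 2 / (1 + 2 * x) ^ 4) x := fun x hx => by
    have := hne x hx
    convert! ((((hasDerivAt_id x).const_sub 1).div (dl x) this).pow 3).const_sub 1 using 1
    simp only [id, Pi.div_apply]
    push_cast
    field_simp
    ring
  have dH : ∀ x ∈ Set.Icc 0 c, ∃ d, HasDerivAt (fun x => (1 + 2 * x) * cubicF (x ^ 3)) d x ∧
      x * (1 - x ^ 3) / (1 + 2 * x) ^ 2 * d = 2 * x * (1 - x ^ 3) / (1 + 2 * x) ^ 2 * cubicF (x ^ 3)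
        + 3 / (1 + 2 * x) * cubicP (x ^ 3) := fun x hx => by
    obtain ⟨d, hd, hdP⟩ := hasDerivAt_cubicF (hv x hx)
    have h1 := hasDerivAt_comp (dv x) hd
    refine ⟨_, (dl x).mul h1, ?_⟩
    have := hne x hx
    rw [← hdP]
    field_simp
  have dG : ∀ x ∈ Set.Icc 0 c, ∃ d,
      HasDerivAt (fun x => cubicF (1 - ((1 - x) / (1 + 2 * x)) ^ 3)) d x ∧
      x * (1 - x ^ 3) / (1 + 2 * x) ^ 2 * d = cubicP (1 - ((1 - x) / (1 + 2 * x)) ^ 3) :=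
    fun x hx => by
    obtain ⟨d, hd, hdP⟩ := hasDerivAt_cubicF (hu x hx)
    refine ⟨_, hasDerivAt_comp (du x hx) hd, ?_⟩
    have := hne x hx
    have e1 : 1 - ((1 - x) / (1 + 2 * x)) ^ 3 = 9 * x * (1 + x + x ^ 2) / (1 + 2 * x) ^ 3 := by
      have h3 := pow_ne_zero 3 this
      rw [div_pow, eq_div_iff h3, sub_mul, div_mul_cancel₀ _ h3]
      ring
    have e2 : 1 - (1 - ((1 - x) / (1 + 2 * x)) ^ 3) = (1 - x) ^ 3 / (1 + 2 * x) ^ 3 := by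
      rw [sub_sub_cancel, div_pow]
    rw [← hdP, e2, e1]
    field_simp
    ring
  have dP : ∀ x ∈ Set.Icc 0 c, HasDerivAt (fun x => 2 * x * (1 - x ^ 3) / (1 + 2 * x) ^ 2
      * cubicF (x ^ 3) + 3 / (1 + 2 * x) * cubicP (x ^ 3))
      (2 * (1 - x) ^ 2 / (1 + 2 * x) ^ 4 * ((1 + 2 * x) * cubicF (x ^ 3))) x := fun x hx => by
    obtain ⟨d, hd, hdP⟩ := hasDerivAt_cubicF (hv x hx)
    have := hne x hx
    have h1 := hasDerivAt_comp (dv x) hd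
    have h2 := hasDerivAt_comp (dv x) (hasDerivAt_cubicP (hv x hx))
    have h3 := (((hasDerivAt_id x).const_mul 2).mul ((dv x).const_sub 1)).div ((dl x).pow 2)
      (pow_ne_zero 2 this)
    have h4 := (hasDerivAt_const x (3 : ℝ)).div (dl x) this
    convert! (h3.mul h1).add (h4.mul h2) using 1
    simp only [id, ← hdP, Pi.pow_apply, Pi.mul_apply, Pi.div_apply]
    push_cast
    field_simp
    ring
  have dQ : ∀ x ∈ Set.Icc 0 c, HasDerivAt (fun x => cubicP (1 - ((1 - x) / (1 + 2 * x)) ^ 3))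
      (2 * (1 - x) ^ 2 / (1 + 2 * x) ^ 4 * cubicF (1 - ((1 - x) / (1 + 2 * x)) ^ 3)) x :=
    fun x hx => by
    convert! hasDerivAt_comp (du x hx) (hasDerivAt_cubicP (hu x hx)) using 1
    ring
  refine eq_of_sturm_liouville (A := fun x => (1 + 2 * x) * cubicF (x ^ 3))
    (B := fun x => cubicF (1 - ((1 - x) / (1 + 2 * x)) ^ 3))
    (w := fun x => x * (1 - x ^ 3) / (1 + 2 * x) ^ 2)
    (q := fun x => 2 * (1 - x) ^ 2 / (1 + 2 * x) ^ 4) hc0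
    (fun x h => (dH x h).choose_spec.1.continuousAt.continuousWithinAt)
    (fun x h => (dG x h).choose_spec.1.continuousAt.continuousWithinAt)
    (fun x h => (dP x h).continuousAt.continuousWithinAt)
    (fun x h => (dQ x h).continuousAt.continuousWithinAt)
    (fun x h => dH x (Set.Ioo_subset_Icc_self h))
    (fun x h => dG x (Set.Ioo_subset_Icc_self h))
    (fun x h => dP x (Set.Ioo_subset_Icc_self h))
    (fun x h => dQ x (Set.Ioo_subset_Icc_self h))
    (fun x h => ?_) (fun x h => ?_) ?_ ?_ ?_
  · have h1 := (abs_lt.mp (hv x (Set.Ioo_subset_Icc_self h))).2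
    exact div_ne_zero (mul_ne_zero h.1.ne' (by linarith))
      (pow_ne_zero 2 (hne x (Set.Ioo_subset_Icc_self h)))
  · exact mul_pos (by linarith [h.1]) (zero_lt_one.trans_le
      (one_le_cubicF (pow_nonneg h.1 3) (abs_lt.mp (hv x h)).2))
  · simp [cubicF_zero]
  · simp [cubicP_zero]
  · simp [cubicP_zero]

/-! ### The Legendre relation -/

lemma gammaSeq_eq_poch (s : ℝ) (n : ℕ) :
    Real.GammaSeq s n = (n : ℝ) ^ s * n.factorial / poch s (n + 1) := by
  have : ∀ m, ∏ j ∈ Finset.range m, (s + (j : ℝ)) = poch s m := fun m => by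
    induction m with
    | zero => simp [poch_zero]
    | succ m ih => rw [Finset.prod_range_succ, ih, poch_succ]
  rw [Real.GammaSeq, this]

lemma tendsto_eulerCoeff_cubic :
    Tendsto (eulerCoeff (gaussCoeff (1 / 3) (2 / 3))) atTop (nhds (√3 / (2 * π))) := by
  have hg := (Real.GammaSeq_tendsto_Gamma (1 / 3)).mul (Real.GammaSeq_tendsto_Gamma (2 / 3))
  have hval : Real.Gamma (1 / 3) * Real.Gamma (2 / 3) = 2 * π / √3 := by
    rw [show (2 / 3 : ℝ) = 1 - 1 / 3 by norm_num, Real.Gamma_mul_Gamma_one_sub,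
      show π * (1 / 3) = π / 3 by ring, Real.sin_pi_div_three]
    field_simp
  rw [hval] at hg
  have hi : ∀ r : ℝ, Tendsto (fun n : ℕ => 1 + r / (n : ℝ)) atTop (nhds 1) := fun r => by
    simpa using (tendsto_const_div_atTop_nhds_zero_nat r).const_add 1
  have h1 := (((hg.mul (hi (1 / 3))).mul (hi (2 / 3)))).inv₀ (by positivity)
  have h2 : (2 * π / √3 * 1 * 1)⁻¹ = √3 / (2 * π) := by
    field_simp
  rw [h2] at h1
  refine h1.congr' ?_
  filter_upwards [eventually_gt_atTop 0] with n hn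
  have hn' : (0 : ℝ) < n := by exact_mod_cast hn
  have hp1 := poch_pos (show (0 : ℝ) < 1 / 3 by norm_num) n
  have hp2 := poch_pos (show (0 : ℝ) < 2 / 3 by norm_num) n
  have hf : (0 : ℝ) < n.factorial := by positivity
  have hr : (n : ℝ) ^ (2 / 3 : ℝ) = n / (n : ℝ) ^ (1 / 3 : ℝ) := by
    rw [show (2 / 3 : ℝ) = 1 - 1 / 3 by norm_num, Real.rpow_sub hn', Real.rpow_one]
  have hr0 : (0 : ℝ) < (n : ℝ) ^ (1 / 3 : ℝ) := by positivity
  rw [gammaSeq_eq_poch, gammaSeq_eq_poch, hr, eulerCoeff, gaussCoeff, poch_succ, poch_succ]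
  have e1 : (1 / 3 : ℝ) + n ≠ 0 := by positivity
  have e2 : (2 / 3 : ℝ) + n ≠ 0 := by positivity
  generalize (n : ℝ) ^ (1 / 3 : ℝ) = r at *
  generalize poch (1 / 3) n = p at *
  generalize poch (2 / 3) n = q at *
  have e3 : (1 : ℝ) + 1 / 3 / n = (1 / 3 + n) / n := by field_simp; ring
  have e4 : (1 : ℝ) + 2 / 3 / n = (2 / 3 + n) / n := by field_simp; ring
  rw [e3, e4]
  generalize (1 / 3 : ℝ) + n = u at *
  generalize (2 / 3 : ℝ) + n = v at *
  field_simp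

lemma tendsto_gaussCoeff_cubic :
    Tendsto (gaussCoeff (1 / 3) (2 / 3)) atTop (nhds 0) := by
  have := tendsto_eulerCoeff_cubic.mul tendsto_inv_atTop_nhds_zero_nat
  rw [mul_zero] at this
  refine this.congr' ?_
  filter_upwards [eventually_gt_atTop 0] with n hn
  have hn' : (n : ℝ) ≠ 0 := by positivity
  rw [eulerCoeff]
  field_simp

/-- The analogue of the Legendre relation for the cubic hypergeometric function. -/
lemma cubicF_legendre {t : ℝ} (ht0 : 0 < t) (ht : t < 1) :
    cubicF t * cubicP (1 - t) + cubicP t * cubicF (1 - t) = √3 / (2 * π) := by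
  have habs : ∀ x ∈ Set.Ioo (0 : ℝ) 1, |x| < 1 := fun x hx => by
    rw [abs_of_pos hx.1]
    exact hx.2
  have hd : ∀ x ∈ Set.Ioo (0 : ℝ) 1, HasDerivAt
      (fun x => cubicF x * cubicP (1 - x) + cubicP x * cubicF (1 - x)) 0 x := fun x hx => by
    have hx' : 1 - x ∈ Set.Ioo (0 : ℝ) 1 := ⟨by linarith [hx.2], by linarith [hx.1]⟩
    obtain ⟨d, hd, hdP⟩ := hasDerivAt_cubicF (habs x hx)
    obtain ⟨e, he, heP⟩ := hasDerivAt_cubicF (habs _ hx')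
    have hs : HasDerivAt (fun x : ℝ => 1 - x) (-1) x := (hasDerivAt_id x).const_sub 1
    have h1 := hasDerivAt_comp hs he
    have h2 := hasDerivAt_comp hs (hasDerivAt_cubicP (habs _ hx'))
    convert! (hd.mul h2).add ((hasDerivAt_cubicP (habs x hx)).mul h1) using 1
    rw [← hdP, ← heP]
    ring
  have hconst : ∀ x ∈ Set.Ioo (0 : ℝ) 1, cubicF x * cubicP (1 - x) + cubicP x * cubicF (1 - x)
      = cubicF t * cubicP (1 - t) + cubicP t * cubicF (1 - t) := fun x hx =>
    isOpen_Ioo.is_const_of_deriv_eq_zero isPreconnected_Ioo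
      (fun y hy => (hd y hy).differentiableAt.differentiableWithinAt)
      (fun y hy => (hd y hy).deriv) hx ⟨ht0, ht⟩
  have hsub : Tendsto (fun x : ℝ => 1 - x) (nhdsWithin 0 (Set.Ioi 0))
      (nhdsWithin 1 (Set.Iio 1)) := by
    refine tendsto_nhdsWithin_iff.mpr ⟨?_, ?_⟩
    · refine Tendsto.mono_left ?_ nhdsWithin_le_nhds
      simpa using (continuous_const.sub continuous_id).tendsto (0 : ℝ) (f := fun x : ℝ => 1 - x)
    · filter_upwards [self_mem_nhdsWithin] with x hx
      simpa using hx
  have l1 : Tendsto (fun x => cubicP (1 - x)) (nhdsWithin 0 (Set.Ioi 0))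
      (nhds (√3 / (2 * π))) :=
    (cubicCoeff_polyBounded.eulerCoeff.tendsto_one_sub_mul_powSum tendsto_eulerCoeff_cubic).comp
      hsub
  have l2 : Tendsto (fun x => (1 - (1 - x)) * cubicF (1 - x)) (nhdsWithin 0 (Set.Ioi 0))
      (nhds 0) :=
    (cubicCoeff_polyBounded.tendsto_one_sub_mul_powSum tendsto_gaussCoeff_cubic).comp hsub
  have l3 : Tendsto cubicF (nhdsWithin 0 (Set.Ioi 0)) (nhds 1) := by
    have := (continuousAt_cubicF (t := 0) (by simp)).tendsto
    rw [cubicF_zero] at this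
    exact this.mono_left nhdsWithin_le_nhds
  have l4 : Tendsto (fun x => (1 - x) * powSum (derivCoeff (gaussCoeff (1 / 3) (2 / 3))) x)
      (nhdsWithin 0 (Set.Ioi 0))
      (nhds ((1 - 0) * powSum (derivCoeff (gaussCoeff (1 / 3) (2 / 3))) 0)) := by
    refine Tendsto.mono_left ?_ nhdsWithin_le_nhds
    exact ((continuousAt_const.sub continuousAt_id).mul
      (cubicCoeff_polyBounded.derivCoeff.continuousAt (by simp))).tendsto
  have l5 := (l3.mul l1).add (l4.mul l2)
  rw [one_mul, mul_zero, add_zero] at l5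
  have l6 : (fun x => cubicF x * cubicP (1 - x)
      + (1 - x) * powSum (derivCoeff (gaussCoeff (1 / 3) (2 / 3))) x
        * ((1 - (1 - x)) * cubicF (1 - x))) =ᶠ[nhdsWithin 0 (Set.Ioi 0)]
      fun _ => cubicF t * cubicP (1 - t) + cubicP t * cubicF (1 - t) := by
    filter_upwards [Ioo_mem_nhdsGT (show (0 : ℝ) < 1 by norm_num)] with x hx
    rw [← hconst x hx]
    have : cubicP x = (1 - x) * (x * powSum (derivCoeff (gaussCoeff (1 / 3) (2 / 3))) x) := by
      rw [cubicP, cubicCoeff_polyBounded.powSum_eulerCoeff (habs x hx)]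
    rw [this]
    ring
  exact tendsto_nhds_unique (tendsto_const_nhds.congr' l6.symm) l5

theorem stmt15 :
    Tendsto (fun N => ∑ n ∈ Finset.range N,
      (poch (1 / 3) n * poch (1 / 2) n * poch (2 / 3) n / (n.factorial : ℝ) ^ 3) *
        (3 * (7 * Real.sqrt 3 - 12) / 2) ^ n * (5 - Real.sqrt 3 + 22 * (n : ℝ)))
      atTop (nhds ((7 + 3 * Real.sqrt 3) / π)) := by
  have hs : √3 ^ 2 = 3 := Real.sq_sqrt (by norm_num)
  have hs1 : 1.7 < √3 := Real.lt_sqrt_of_sq_lt (by norm_num)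
  have hs2 : √3 < 1.8 := (Real.sqrt_lt' (by norm_num)).mpr (by norm_num)
  have hx3 : ((√3 - 1) / 2) ^ 3 = (3 * √3 - 5) / 4 := by
    linear_combination (√3 - 3) / 8 * hs
  have hl : 1 + 2 * ((√3 - 1) / 2) = √3 := by ring
  have hy : (1 - (√3 - 1) / 2) / √3 = (√3 - 1) / 2 := by
    rw [div_eq_iff (by linarith)]
    linear_combination -hs / 2
  obtain ⟨hF, hP⟩ := cubicF_cubic_transformation (c := (√3 - 1) / 2) (by linarith) (by linarith)
  rw [hl, hy, hx3, hs] at hP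
  rw [hl, hy, hx3] at hF
  have hW := cubicF_legendre (t := (3 * √3 - 5) / 4) (by linarith) (by linarith)
  obtain ⟨hK, hL⟩ := cubicF_quadratic_transformation (c := (3 * √3 - 5) / 4) (by linarith)
    (by linarith)
  have hz : 4 * ((3 * √3 - 5) / 4) * (1 - (3 * √3 - 5) / 4) = 3 * (7 * √3 - 12) / 2 := by
    linear_combination -9 / 4 * hs
  have hz1 : |3 * (7 * √3 - 12) / 2| < 1 := by
    rw [← hz, abs_of_nonneg (mul_nonneg (by linarith) (by linarith))]
    nlinarith
  rw [hz] at hK hL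
  have hS := powSum_clausenCoeff hz1
  have hT := powSum_eulerCoeff_clausenCoeff hz1
  rw [← hK] at hS hT
  have hT' : (7 - 3 * √3) / 2 * powSum (eulerCoeff clausenCoeff) (3 * (7 * √3 - 12) / 2)
      = 2 * cubicF ((3 * √3 - 5) / 4) * cubicP ((3 * √3 - 5) / 4) := by
    rw [hT, hL]
    ring
  have hC := clausenCoeff_polyBounded
  have hsum := ((hC.summable hz1).hasSum.mul_left (5 - √3)).add
    ((hC.eulerCoeff.summable hz1).hasSum.mul_left 22)
  change HasSum _ ((5 - √3) * powSum clausenCoeff (3 * (7 * √3 - 12) / 2)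
    + 22 * powSum (eulerCoeff clausenCoeff) (3 * (7 * √3 - 12) / 2)) at hsum
  have hval : (5 - √3) * powSum clausenCoeff (3 * (7 * √3 - 12) / 2)
      + 22 * powSum (eulerCoeff clausenCoeff) (3 * (7 * √3 - 12) / 2)
      = (7 + 3 * √3) / π := by
    rw [← hF, ← hP] at hW
    have h1 : (2 * √3 - 3) / 2 * powSum clausenCoeff (3 * (7 * √3 - 12) / 2)
        + (7 * √3 - 9) / 2 * powSum (eulerCoeff clausenCoeff) (3 * (7 * √3 - 12) / 2)
        = √3 / (2 * π) := by
      rw [← hW, hS]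
      have h3 : 3 / √3 = √3 := by rw [div_eq_iff (by linarith)]; linarith
      rw [h3]
      linear_combination √3 * hT' + (cubicF ((3 * √3 - 5) / 4) ^ 2 / 4
        + 3 / 2 * powSum (eulerCoeff clausenCoeff) (3 * (7 * √3 - 12) / 2)) * hs
    have h2 : (7 + 3 * √3) / π = 2 / 3 * (7 * √3 + 9) * (√3 / (2 * π)) := by
      field_simp
      linear_combination -7 * hs
    rw [h2, ← h1]
    generalize powSum clausenCoeff (3 * (7 * √3 - 12) / 2) = S
    generalize powSum (eulerCoeff clausenCoeff) (3 * (7 * √3 - 12) / 2) = T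
    linear_combination (-14 / 3 * S - 49 / 3 * T) * hs
  rw [hval] at hsum
  refine hsum.tendsto_sum_nat.congr fun N => Finset.sum_congr rfl fun n _ => ?_
  rw [eulerCoeff, clausenCoeff]
  ring
end

section
/- The series ∑_{n=0}^∞ ((1/6)_n (1/2)_n (5/6)_n / (n!)³) · (4/125)^n · (1 + 11n) converges to 5√15/(6π). -/
open Real Filter

lemma poch_add (a : ℝ) (n j : ℕ) : poch a (n + j) = poch a n * poch (a + n) j := by
  induction j with
  | zero => simp [poch_zero]
  | succ j ih =>
    rw [← add_assoc, poch_succ, poch_succ, ih]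
    push_cast
    ring

lemma poch_half_three_mul (n : ℕ) :
    poch (1 / 2) (3 * n) = 27 ^ n * (poch (1 / 6) n * poch (1 / 2) n * poch (5 / 6) n) := by
  induction n with
  | zero => simp [poch_zero]
  | succ n ih =>
    rw [show 3 * (n + 1) = 3 * n + 1 + 1 + 1 by ring]
    simp only [poch_succ, ih]
    push_cast
    ring

/-- The squared Wallis ratio `(1/2)_k / k!` in terms of the Wallis product. -/
lemma sq_poch_half_div_factorial (k : ℕ) :
    (poch (1 / 2) k / (k.factorial : ℝ)) ^ 2 = (Real.Wallis.W k * (2 * k + 1))⁻¹ := by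
  induction k with
  | zero => simp [poch_zero, Real.Wallis.W]
  | succ k ih =>
    have hW := (Real.Wallis.W_pos k).ne'
    rw [poch_succ, Nat.factorial_succ, Real.Wallis.W_succ,
      show poch (1 / 2) k * (1 / 2 + k) / (((k + 1) * k.factorial : ℕ) : ℝ)
        = poch (1 / 2) k / k.factorial * ((1 / 2 + k) / (k + 1)) by
          push_cast; field_simp, mul_pow, ih]
    push_cast
    field_simp
    ring

lemma sq_poch_half_div_factorial_le (k : ℕ) :
    (poch (1 / 2) k / (k.factorial : ℝ)) ^ 2 ≤ 1 / (2 * k + 1) := by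
  induction k with
  | zero => simp [poch_zero]
  | succ k ih =>
    rw [poch_succ, Nat.factorial_succ,
      show poch (1 / 2) k * (1 / 2 + k) / (((k + 1) * k.factorial : ℕ) : ℝ)
        = poch (1 / 2) k / k.factorial * ((1 / 2 + k) / (k + 1)) by
          push_cast; field_simp, mul_pow]
    refine (mul_le_mul_of_nonneg_right ih (sq_nonneg _)).trans ?_
    push_cast
    rw [div_pow, div_mul_div_comm, div_le_div_iff₀ (by positivity) (by positivity)]
    have : (0 : ℝ) ≤ k := k.cast_nonneg
    nlinarith [mul_nonneg this this]

lemma poch_half_le_factorial (k : ℕ) : poch (1 / 2) k ≤ k.factorial := by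
  induction k with
  | zero => simp [poch_zero]
  | succ k ih =>
    rw [poch_succ, Nat.factorial_succ, mul_comm]
    push_cast
    have := (poch_pos (a := 1 / 2) (by norm_num) k).le
    exact mul_le_mul (by linarith) ih this (by positivity)

/-- The hypergeometric factor of the Wilf–Zeilberger pair `(wzTerm, 8 n · wzKernel)`. -/
noncomputable def wzKernel (n k : ℕ) : ℝ :=
  poch (1 / 2) n ^ 3 * poch (1 / 2) k ^ 2 /
    (n.factorial * ((k + n).factorial : ℝ) ^ 2 * 4 ^ n)

/-- A deformation in `k` of the terms of Ramanujan's series `∑ (1/2)_n³ (6n+1) / (n!³ 4ⁿ)`,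
with sum independent of `k`. -/
noncomputable def wzTerm (n k : ℕ) : ℝ := wzKernel n k * (6 * n + 4 * k + 1)

lemma wzKernel_nonneg (n k : ℕ) : 0 ≤ wzKernel n k := by
  have := (poch_pos (a := 1 / 2) (by norm_num) n).le
  unfold wzKernel
  positivity

lemma wzTerm_nonneg (n k : ℕ) : 0 ≤ wzTerm n k :=
  mul_nonneg (wzKernel_nonneg n k) (by positivity)

lemma wzTerm_succ_sub (n k : ℕ) :
    wzTerm n (k + 1) - wzTerm n k
      = 8 * ((n + 1 : ℕ) : ℝ) * wzKernel (n + 1) k - 8 * n * wzKernel n k := by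
  have h1 : wzKernel n (k + 1) = wzKernel n k * ((k + 1 / 2) / (k + n + 1)) ^ 2 := by
    unfold wzKernel
    rw [show k + 1 + n = k + n + 1 by ring, Nat.factorial_succ, poch_succ]
    push_cast
    field_simp
    ring
  have h2 : wzKernel (n + 1) k
      = wzKernel n k * ((n + 1 / 2) ^ 3 / (4 * (n + 1) * (k + n + 1) ^ 2)) := by
    unfold wzKernel
    rw [← add_assoc, Nat.factorial_succ, Nat.factorial_succ, poch_succ]
    push_cast
    field_simp
    ring
  unfold wzTerm
  rw [h1, h2]
  push_cast
  field_simp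
  ring

lemma wzKernel_le (n k : ℕ) :
    wzKernel n k ≤ (1 / 4) ^ n * (poch (1 / 2) k / (k.factorial : ℝ)) ^ 2 := by
  have hn := (poch_pos (a := 1 / 2) (by norm_num) n).le
  have hle := poch_half_le_factorial n
  have hf : ((k.factorial : ℝ) * n.factorial) ≤ (k + n).factorial := by
    exact_mod_cast Nat.le_of_dvd (k + n).factorial_pos
      (Nat.factorial_mul_factorial_dvd_factorial_add k n)
  calc wzKernel n k
      ≤ (n.factorial : ℝ) ^ 3 * poch (1 / 2) k ^ 2 /
        (n.factorial * ((k.factorial : ℝ) * n.factorial) ^ 2 * 4 ^ n) := by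
        unfold wzKernel
        gcongr
    _ = _ := by
        rw [one_div_pow]
        field_simp

lemma wzTerm_le (n k : ℕ) : wzTerm n k ≤ (1 / 4) ^ n * (6 * n + 2) := by
  have h := (wzKernel_le n k).trans
    (mul_le_mul_of_nonneg_left (sq_poch_half_div_factorial_le k) (by positivity))
  refine (mul_le_mul_of_nonneg_right h (by positivity)).trans ?_
  rw [mul_assoc]
  gcongr
  rw [div_mul_eq_mul_div, div_le_iff₀ (by positivity)]
  have h1 : (0 : ℝ) ≤ n := n.cast_nonneg
  have h2 : (0 : ℝ) ≤ k := k.cast_nonneg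
  nlinarith [mul_nonneg h1 h2]

lemma summable_wzBound : Summable fun n : ℕ => (1 / 4 : ℝ) ^ n * (6 * n + 2) := by
  have h1 := (summable_pow_mul_geometric_of_norm_lt_one 1
    (show ‖(1 / 4 : ℝ)‖ < 1 by norm_num)).mul_left 6
  have h0 := (summable_geometric_of_lt_one (show (0 : ℝ) ≤ 1 / 4 by norm_num)
    (by norm_num)).mul_left 2
  refine (h1.add h0).congr fun n => ?_
  ring

lemma summable_wzTerm (k : ℕ) : Summable fun n => wzTerm n k :=
  summable_wzBound.of_nonneg_of_le (fun n => wzTerm_nonneg n k) fun n => wzTerm_le n k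

lemma tsum_wzTerm_succ (k : ℕ) : ∑' n, wzTerm n (k + 1) = ∑' n, wzTerm n k := by
  have h := ((summable_wzTerm (k + 1)).hasSum.sub (summable_wzTerm k).hasSum).tendsto_sum_nat
  simp only [wzTerm_succ_sub] at h
  have h0 : Tendsto (fun N : ℕ => 8 * (N : ℝ) * wzKernel N k) atTop (nhds 0) := by
    have ht := ((summable_wzTerm k).tendsto_atTop_zero).const_mul 2
    rw [mul_zero] at ht
    refine squeeze_zero (fun n => mul_nonneg (by positivity) (wzKernel_nonneg n k))
      (fun n => ?_) ht
    have := wzKernel_nonneg n k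
    unfold wzTerm
    have h1 : (0 : ℝ) ≤ n := n.cast_nonneg
    have h2 : (0 : ℝ) ≤ k := k.cast_nonneg
    nlinarith [mul_nonneg this h1, mul_nonneg this h2]
  have h' : Tendsto (fun N : ℕ => 8 * (N : ℝ) * wzKernel N k) atTop
      (nhds (∑' n, wzTerm n (k + 1) - ∑' n, wzTerm n k)) := by
    refine h.congr fun N => ?_
    rw [Finset.sum_range_sub fun n : ℕ => 8 * (n : ℝ) * wzKernel n k]
    simp
  exact sub_eq_zero.mp (tendsto_nhds_unique h' h0)

lemma tendsto_wzTerm_zero : Tendsto (fun k => wzTerm 0 k) atTop (nhds (4 / π)) := by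
  have h1 : Tendsto (fun k : ℕ => 2 - 1 / (2 * (k : ℝ) + 1)) atTop (nhds (2 - 0)) := by
    refine tendsto_const_nhds.sub (tendsto_const_nhds.div_atTop ?_)
    exact tendsto_atTop_add_const_right _ _
      (tendsto_natCast_atTop_atTop.const_mul_atTop (by norm_num))
  have h := h1.div Real.Wallis.tendsto_W_nhds_pi_div_two (by positivity)
  rw [show (2 - 0 : ℝ) / (π / 2) = 4 / π by field_simp; norm_num] at h
  refine h.congr fun k => ?_
  have hW := (Real.Wallis.W_pos k).ne'
  have hk := sq_poch_half_div_factorial k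
  rw [div_pow] at hk
  simp only [Pi.div_apply, wzTerm, wzKernel, poch_zero, Nat.factorial_zero, add_zero, pow_zero,
    Nat.cast_one, one_pow, one_mul, mul_one, hk]
  push_cast
  field_simp
  ring

lemma tendsto_wzTerm_succ (n : ℕ) : Tendsto (fun k => wzTerm (n + 1) k) atTop (nhds 0) := by
  have hb (k : ℕ) : wzTerm (n + 1) k
      ≤ (poch (1 / 2) (n + 1) ^ 3 * (6 * n + 7)) * (4 / ((k : ℝ) + 1)) := by
    have hn := (poch_pos (a := 1 / 2) (by norm_num) (n + 1)).le
    have hk0 := (poch_pos (a := 1 / 2) (by norm_num) k).le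
    have hk := poch_half_le_factorial k
    have hf : ((k : ℝ) + 1) * k.factorial ≤ (k + (n + 1)).factorial := by
      have := Nat.factorial_le (show k + 1 ≤ k + (n + 1) by omega)
      rw [Nat.factorial_succ k] at this
      exact_mod_cast this
    have h1 : (1 : ℝ) ≤ (n + 1).factorial := by exact_mod_cast (n + 1).factorial_pos
    have h4 : (1 : ℝ) ≤ 4 ^ (n + 1) := one_le_pow₀ (by norm_num)
    have hK : wzKernel (n + 1) k ≤ poch (1 / 2) (n + 1) ^ 3 * (1 / ((k : ℝ) + 1) ^ 2) := by
      calc wzKernel (n + 1) k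
          ≤ poch (1 / 2) (n + 1) ^ 3 * (k.factorial : ℝ) ^ 2 /
            (1 * (((k : ℝ) + 1) * k.factorial) ^ 2 * 1) := by
            unfold wzKernel
            gcongr
        _ = _ := by field_simp
    refine (mul_le_mul_of_nonneg_right hK (by positivity)).trans ?_
    rw [mul_assoc, mul_assoc]
    refine mul_le_mul_of_nonneg_left ?_ (by positivity)
    rw [div_mul_eq_mul_div, ← mul_div_assoc, div_le_div_iff₀ (by positivity) (by positivity)]
    push_cast
    have h1 : (0 : ℝ) ≤ n := n.cast_nonneg
    have h2 : (0 : ℝ) ≤ k := k.cast_nonneg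
    nlinarith [mul_nonneg h1 h2, mul_nonneg h2 h2, mul_nonneg (mul_nonneg h1 h2) h2]
  refine squeeze_zero (fun k => wzTerm_nonneg _ k) hb ?_
  rw [← mul_zero (poch (1 / 2) (n + 1) ^ 3 * (6 * n + 7) : ℝ)]
  exact (tendsto_const_nhds.div_atTop
    (tendsto_atTop_add_const_right _ _ tendsto_natCast_atTop_atTop)).const_mul _

/-- Ramanujan's series `∑ (1/2)_n³ / n!³ · (6n+1) / 4ⁿ = 4/π`. -/
lemma hasSum_ramanujan_quarter :
    HasSum (fun n : ℕ => (poch (1 / 2) n / (n.factorial : ℝ)) ^ 3 * (6 * n + 1) / 4 ^ n)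
      (4 / π) := by
  have hconst (k : ℕ) : ∑' n, wzTerm n k = ∑' n, wzTerm n 0 := by
    induction k with
    | zero => rfl
    | succ k ih => rw [tsum_wzTerm_succ, ih]
  have hlim : Tendsto (fun k => ∑' n, wzTerm n k) atTop
      (nhds (∑' n : ℕ, if n = 0 then 4 / π else 0)) := by
    refine tendsto_tsum_of_dominated_convergence summable_wzBound (fun n => ?_)
      (Eventually.of_forall fun k n => ?_)
    · cases n with
      | zero => simpa using tendsto_wzTerm_zero
      | succ n => simpa using tendsto_wzTerm_succ n
    · rw [Real.norm_of_nonneg (wzTerm_nonneg n k)]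
      exact wzTerm_le n k
  simp only [hconst, tsum_ite_eq] at hlim
  rw [← tendsto_nhds_unique tendsto_const_nhds hlim]
  convert (summable_wzTerm 0).hasSum using 2 with n
  simp only [wzTerm, wzKernel, poch_zero, zero_add]
  push_cast
  field_simp
  ring

/-- `desc x k = x (x-1) ⋯ (x-k+1)`, the falling factorial. -/
noncomputable def desc (x : ℝ) (k : ℕ) : ℝ := (descPochhammer ℝ k).eval x

lemma desc_zero (x : ℝ) : desc x 0 = 1 := by simp [desc]

lemma desc_succ (x : ℝ) (k : ℕ) : desc x (k + 1) = desc x k * (x - k) :=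
  descPochhammer_succ_eval k x

lemma desc_add_one_succ (x : ℝ) (k : ℕ) : desc (x + 1) (k + 1) = (x + 1) * desc x k := by
  simp [desc, descPochhammer_succ_left, Polynomial.eval_comp]

lemma desc_natCast (m k : ℕ) : desc m k = m.descFactorial k :=
  descPochhammer_eval_eq_descFactorial ℝ m k

/-- The summand of the terminating Saalschützian sum that evaluates to `4ᵐ (1/2)_m³ / m!³`. -/
noncomputable def saalTerm (m n : ℕ) : ℝ :=
  poch (1 / 2) (m + n) * desc m (2 * n) / (4 ^ n * (n.factorial : ℝ) ^ 3 * m.factorial)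

lemma saalTerm_nonneg (m n : ℕ) : 0 ≤ saalTerm m n := by
  have := (poch_pos (a := 1 / 2) (by norm_num) (m + n)).le
  unfold saalTerm
  rw [desc_natCast]
  positivity

lemma saalTerm_eq_zero {m n : ℕ} (h : m < 2 * n) : saalTerm m n = 0 := by
  simp [saalTerm, desc_natCast, Nat.descFactorial_of_lt h]

lemma saalTerm_two_mul_add (n j : ℕ) :
    saalTerm (2 * n + j) n
      = poch (1 / 2) (3 * n) * (poch (3 * n + 1 / 2) j / j.factorial) /
        (4 ^ n * (n.factorial : ℝ) ^ 3) := by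
  have h : ((2 * n + j).factorial : ℝ) = j.factorial * (2 * n + j).descFactorial (2 * n) := by
    have := Nat.factorial_mul_descFactorial (show 2 * n ≤ 2 * n + j by omega)
    rw [Nat.add_sub_cancel_left] at this
    exact_mod_cast this.symm
  have h0 : ((2 * n + j).descFactorial (2 * n) : ℝ) ≠ 0 := by
    rw [Nat.cast_ne_zero, Ne, Nat.descFactorial_eq_zero_iff_lt]
    omega
  unfold saalTerm
  rw [desc_natCast, h, show 2 * n + j + n = 3 * n + j by ring, poch_add,
    show (1 / 2 + ((3 * n : ℕ) : ℝ)) = 3 * n + 1 / 2 by push_cast; ring]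
  field_simp

/-- The Wilf–Zeilberger certificate for `saalTerm`. -/
noncomputable def saalCert (m n : ℕ) : ℝ :=
  -4 * (3 * m + 2) * n ^ 3 * (poch (1 / 2) (m + n) * desc (m + 1) (2 * n) /
    (4 ^ n * (n.factorial : ℝ) ^ 3 * (m + 1).factorial))

lemma saalTerm_recurrence (m n : ℕ) :
    ((m : ℝ) + 1) ^ 3 * saalTerm (m + 1) n - 4 * (m + 1 / 2) ^ 3 * saalTerm m n
      = saalCert m (n + 1) - saalCert m n := by
  have hd : desc m (2 * n) = desc (m + 1) (2 * n) * (m + 1 - 2 * n) / (m + 1) := by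
    rw [eq_div_iff (by positivity), mul_comm, ← desc_add_one_succ, desc_succ]
    push_cast
    ring
  unfold saalTerm saalCert
  rw [show m + 1 + n = m + n + 1 by ring, show 2 * (n + 1) = 2 * n + 1 + 1 by ring, ← add_assoc,
    desc_add_one_succ, desc_succ, poch_succ, Nat.factorial_succ, Nat.factorial_succ, hd]
  push_cast
  field_simp
  ring

lemma sum_saalTerm (m : ℕ) :
    ∑ n ∈ Finset.range (m + 1), saalTerm m n
      = 4 ^ m * (poch (1 / 2) m / (m.factorial : ℝ)) ^ 3 := by
  induction m with
  | zero => simp [saalTerm, poch_zero, desc_zero]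
  | succ m ih =>
    have hs := Finset.sum_range_sub (saalCert m) (m + 2)
    have h0 : saalCert m 0 = 0 := by simp [saalCert]
    have h1 : saalCert m (m + 2) = 0 := by
      have : desc ((m : ℝ) + 1) (2 * (m + 2)) = 0 := by
        have := desc_natCast (m + 1) (2 * (m + 2))
        rw [Nat.descFactorial_of_lt (by omega)] at this
        exact_mod_cast this
      simp [saalCert, this]
    rw [h0, h1, sub_zero, ← Finset.sum_congr rfl fun n _ => saalTerm_recurrence m n,
      Finset.sum_sub_distrib, ← Finset.mul_sum, ← Finset.mul_sum,
      Finset.sum_range_succ (saalTerm m) (m + 1), ih, saalTerm_eq_zero (by omega), add_zero,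
      sub_eq_zero] at hs
    have hm : ((m : ℝ) + 1) ^ 3 ≠ 0 := by positivity
    refine mul_left_cancel₀ hm (hs.trans ?_)
    rw [poch_succ, Nat.factorial_succ]
    push_cast
    field_simp
    ring

lemma hasSum_poch_div_factorial (a : ℝ) {y : ℝ} (hy : |y| < 1) :
    HasSum (fun j : ℕ => poch a j / j.factorial * y ^ j) (1 / (1 - y) ^ a) := by
  have h := (Real.one_div_one_sub_rpow_hasFPowerSeriesOnBall_zero a).hasSum (y := y)
    (by simpa [enorm_eq_nnnorm, ← NNReal.coe_lt_one] using hy)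
  simp only [zero_add, FormalMultilinearSeries.ofScalars_apply_eq] at h
  refine (funext fun j => ?_ : (fun j : ℕ => poch a j / j.factorial * y ^ j) = _) ▸ h
  have hj := Ring.factorial_nsmul_multichoose_eq_ascPochhammer a j
  rw [Polynomial.ascPochhammer_smeval_eq_eval, nsmul_eq_mul, Ring.multichoose_eq] at hj
  rw [poch, ← hj, smul_eq_mul]
  field_simp

lemma hasSum_mul_poch_div_factorial (a : ℝ) {y : ℝ} (hy : |y| < 1) :
    HasSum (fun j : ℕ => j * (poch a j / j.factorial * y ^ j))
      (a * y * (1 / (1 - y) ^ (a + 1))) := by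
  rw [← hasSum_nat_add_iff' 1]
  simp only [Finset.sum_range_one, Nat.cast_zero, zero_mul, sub_zero]
  have hs := (hasSum_poch_div_factorial (a + 1) hy).mul_left (a * y)
  refine (funext fun j => ?_ : (fun j : ℕ => ((j + 1 : ℕ) : ℝ) *
    (poch a (j + 1) / (j + 1).factorial * y ^ (j + 1))) = _) ▸ hs
  have h := poch_add a 1 j
  rw [poch_succ, poch_zero, one_mul, Nat.cast_zero, add_zero, Nat.cast_one, add_comm 1 j] at h
  rw [h, Nat.factorial_succ, pow_succ]
  push_cast
  field_simp

/-- Summing over one column of the double series. -/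
lemma hasSum_column (n : ℕ) :
    HasSum (fun m : ℕ => (6 * m + 1) * saalTerm m n / 16 ^ m)
      (6 / 5 * √(16 / 15) * (poch (1 / 6) n * poch (1 / 2) n * poch (5 / 6) n /
        (n.factorial : ℝ) ^ 3 * (4 / 125) ^ n * (1 + 11 * (n : ℝ)))) := by
  have hy : |(1 / 16 : ℝ)| < 1 := by rw [abs_of_pos] <;> norm_num
  set a : ℝ := 3 * n + 1 / 2 with ha
  have hinj : Function.Injective fun j : ℕ => 2 * n + j := add_right_injective _
  rw [← hinj.hasSum_iff]
  · have h := (((hasSum_poch_div_factorial a hy).mul_left (12 * n + 1 : ℝ)).add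
      ((hasSum_mul_poch_div_factorial a hy).mul_left 6)).mul_left
      (poch (1 / 2) (3 * n) / (4 ^ n * (n.factorial : ℝ) ^ 3 * 16 ^ (2 * n)) : ℝ)
    have hpow : 1 / (1 - 1 / 16 : ℝ) ^ a = (4096 / 3375) ^ n * √(16 / 15) := by
      rw [one_div, ← Real.inv_rpow (by norm_num), ha, Real.rpow_add (by norm_num),
        Real.rpow_mul (by norm_num), Real.rpow_natCast, Real.sqrt_eq_rpow]
      norm_num
    have hpow' : 1 / (1 - 1 / 16 : ℝ) ^ (a + 1) = 16 / 15 * (1 / (1 - 1 / 16 : ℝ) ^ a) := by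
      rw [Real.rpow_add (by norm_num), Real.rpow_one]
      field_simp
      norm_num
    have hval : poch (1 / 2) (3 * n) / (4 ^ n * (n.factorial : ℝ) ^ 3 * 16 ^ (2 * n)) *
        ((12 * n + 1) * (1 / (1 - 1 / 16) ^ a) +
          6 * (a * (1 / 16) * (1 / (1 - 1 / 16) ^ (a + 1))))
        = 6 / 5 * √(16 / 15) * (poch (1 / 6) n * poch (1 / 2) n * poch (5 / 6) n /
          (n.factorial : ℝ) ^ 3 * (4 / 125) ^ n * (1 + 11 * (n : ℝ))) := by
      rw [hpow', hpow, poch_half_three_mul, pow_mul, ha,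
        show (4 / 125 : ℝ) ^ n = 27 ^ n * (4096 / 3375) ^ n / (4 ^ n * (16 ^ 2) ^ n) by
          rw [← mul_pow, ← mul_pow, ← div_pow]; norm_num]
      field_simp
      ring
    rw [hval] at h
    refine (funext fun j => ?_ : (fun m : ℕ => (6 * m + 1) * saalTerm m n / 16 ^ m) ∘
      (fun j : ℕ => 2 * n + j) = _) ▸ h
    simp only [Function.comp_apply, saalTerm_two_mul_add, ← ha]
    rw [pow_add, one_div_pow]
    push_cast
    field_simp
    ring
  · intro m hm
    rw [saalTerm_eq_zero, mul_zero, zero_div]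
    by_contra! h
    exact hm ⟨m - 2 * n, by simp only; omega⟩

lemma hasSum_row (m : ℕ) :
    HasSum (fun n : ℕ => (6 * m + 1) * saalTerm m n / 16 ^ m)
      ((poch (1 / 2) m / (m.factorial : ℝ)) ^ 3 * (6 * m + 1) / 4 ^ m) := by
  have h : HasSum (saalTerm m) (∑ n ∈ Finset.range (m + 1), saalTerm m n) := by
    refine hasSum_sum_of_ne_finset_zero fun n hn => saalTerm_eq_zero ?_
    rw [Finset.mem_range] at hn
    omega
  rw [sum_saalTerm] at h
  have hval : (6 * m + 1 : ℝ) * (4 ^ m * (poch (1 / 2) m / (m.factorial : ℝ)) ^ 3) / 16 ^ m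
      = (poch (1 / 2) m / (m.factorial : ℝ)) ^ 3 * (6 * m + 1) / 4 ^ m := by
    rw [show (16 : ℝ) = 4 * 4 by norm_num, mul_pow]
    field_simp
  exact hval ▸ (h.mul_left (6 * m + 1 : ℝ)).div_const (16 ^ m)

theorem stmt16 :
    Tendsto (fun N => ∑ n ∈ Finset.range N,
      (poch (1 / 6) n * poch (1 / 2) n * poch (5 / 6) n / (n.factorial : ℝ) ^ 3) *
        (4 / 125) ^ n * (1 + 11 * (n : ℝ)))
      atTop (nhds (5 * Real.sqrt 15 / (6 * π))) := by
  let F : ℕ × ℕ → ℝ := fun p => (6 * p.1 + 1) * saalTerm p.1 p.2 / 16 ^ p.1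
  have hF : 0 ≤ F := fun p => by
    have := saalTerm_nonneg p.1 p.2
    simp only [Pi.zero_apply, F]
    positivity
  have hsummable : Summable F := by
    refine (summable_prod_of_nonneg hF).2 ⟨fun m => (hasSum_row m).summable, ?_⟩
    exact hasSum_ramanujan_quarter.summable.congr fun m => (hasSum_row m).tsum_eq.symm
  have hsum : HasSum F (4 / π) := by
    have h := hsummable.hasSum.prod_fiberwise hasSum_row
    exact h.unique hasSum_ramanujan_quarter ▸ hsummable.hasSum
  have hswap : HasSum (F ∘ Prod.swap) (4 / π) := (Equiv.prodComm ℕ ℕ).hasSum_iff.2 hsum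
  have h := ((hswap.prod_fiberwise hasSum_column).div_const (6 / 5 * √(16 / 15))).tendsto_sum_nat
  have h15 : √(16 / 15 : ℝ) = 4 / √15 := by
    rw [Real.sqrt_div (by norm_num), show (16 : ℝ) = 4 ^ 2 by norm_num,
      Real.sqrt_sq (by norm_num)]
  convert h using 2
  · refine Finset.sum_congr rfl fun n _ => ?_
    rw [mul_div_cancel_left₀ _ (by positivity)]
  · rw [h15]
    field_simp
end
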